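/- arXiv:2011.02244 — 3 statements merged into one kernel-verified Lean document; each statement's English description precedes it below -/
import Mathlib

section
/- Let p, q ∈ ℤ² with p∧q ≠ 0. (a) If q is of type I₊ relative to p, then there exists ν₀ᵖ > 0 such that for every ν ∈ (0, ν₀ᵖ) there exists λ > 0 with a₀(λ,ν) + g(λ,ν) = 0, where g(λ,ν) = lim_{k→∞}[a_{−1}(λ,ν);…;a_{−k}(λ,ν)] exists. (b) If q is of type I₋ relative to p, then there exists ν₀ᵐ > 0 such that for every ν ∈ (0, ν₀ᵐ) there exists λ > 0 with a₀(λ,ν) + f(λ,ν) = 0, where f(λ,ν) = lim_{k→∞}[a₁(λ,ν);…;a_k(λ,ν)] exists. -/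
open Filter Finset Topology

noncomputable section

/-- Squared Euclidean norm of an integer vector. -/
def nsq (v : ℤ × ℤ) : ℝ := (v.1 : ℝ) ^ 2 + (v.2 : ℝ) ^ 2

/-- Wedge (cross) product of two integer vectors. -/
def wedge (p q : ℤ × ℤ) : ℤ := p.1 * q.2 - p.2 * q.1

/-- The lattice point `q + n • p`. -/
def pt (q p : ℤ × ℤ) (n : ℤ) : ℤ × ℤ := (q.1 + n * p.1, q.2 + n * p.2)

/-- ρ_n = 1 - ‖p‖²/‖q+np‖². -/
def rho (p q : ℤ × ℤ) (n : ℤ) : ℝ := 1 - nsq p / nsq (pt q p n)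

/-- `q` is of type I₀ relative to `p`. -/
def typeI0 (p q : ℤ × ℤ) : Prop :=
  nsq q < nsq p ∧ ∀ n : ℤ, n ≠ 0 → nsq p < nsq (pt q p n)

/-- a_n(λ,ν) = (λ + ν‖q+np‖²)/ρ_n. -/
def acoef (p q : ℤ × ℤ) (lam ν : ℝ) (n : ℤ) : ℝ :=
  (lam + ν * nsq (pt q p n)) / rho p q n

/-- Membership in the weighted space ℓ²_s(ℤ). -/
def memL2s (s : ℝ) (w : ℤ → ℝ) : Prop :=
  Summable fun n : ℤ => (1 + |(n : ℝ)| ^ (2 * s)) * (w n) ^ 2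

/-- Finite continued fraction `[x₁; x₂; …; x_k] = 1/(x₁ + 1/(x₂ + ⋯ + 1/x_k))`. -/
def cfL : List ℝ → ℝ
  | [] => 0
  | x :: xs => 1 / (x + cfL xs)

/-- `q` is of type I₊ relative to `p`. -/
def typeIp (p q : ℤ × ℤ) : Prop :=
  nsq q < nsq p ∧ nsq (pt q p 1) = nsq p ∧
    ∀ n : ℤ, n ≠ 0 → n ≠ 1 → nsq p < nsq (pt q p n)

/-- `q` is of type I₋ relative to `p`. -/
def typeIm (p q : ℤ × ℤ) : Prop :=
  nsq q < nsq p ∧ nsq (pt q p (-1)) = nsq p ∧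
    ∀ n : ℤ, n ≠ 0 → n ≠ -1 → nsq p < nsq (pt q p n)

def CF : ℕ → (ℕ → ℝ) → ℝ
  | 0, _ => 0
  | k + 1, a => 1 / (a 0 + CF k (fun n => a (n + 1)))

lemma CF_eq (k : ℕ) : ∀ a : ℕ → ℝ, cfL ((List.range k).map a) = CF k a := by
  induction k with
  | zero => intro a; simp [cfL, CF]
  | succ k ih =>
    intro a
    rw [List.range_succ_eq_map, List.map_cons, List.map_map, cfL, CF, ← ih]
    rfl

lemma CF_nonneg (k : ℕ) : ∀ a : ℕ → ℝ, (∀ n, 0 < a n) → 0 ≤ CF k a := by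
  induction k with
  | zero => intro a _; simp [CF]
  | succ k ih =>
    intro a ha
    have := ih (fun n => a (n + 1)) (fun n => ha _)
    have := ha 0
    rw [CF]; positivity

lemma CF_le (k : ℕ) (a : ℕ → ℝ) (d : ℝ) (hd : 0 < d) (ha : ∀ n, d ≤ a n) : CF k a ≤ 1 / d := by
  cases k with
  | zero => simp only [CF]; positivity
  | succ k =>
    have := CF_nonneg k (fun n => a (n + 1)) (fun n => hd.trans_le (ha _))
    have := ha 0
    rw [CF]
    exact one_div_le_one_div_of_le hd (by linarith)

lemma two_step (a b x y d : ℝ) (hd : 0 < d) (ha : d ≤ a) (hb : d ≤ b) (hx : 0 ≤ x) (hy : 0 ≤ y) :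
    |1 / (a + 1 / (b + x)) - 1 / (a + 1 / (b + y))| ≤ 1 / (1 + d ^ 2) * |x - y| := by
  have ha0 : 0 < a := hd.trans_le ha
  have hb0 : 0 < b := hd.trans_le hb
  have hX : 0 < b + x := by positivity
  have hY : 0 < b + y := by positivity
  have hab : d ^ 2 ≤ a * (b + x) := by nlinarith
  have hab' : 0 < a * (b + y) := by positivity
  have e : 1 / (a + 1 / (b + x)) - 1 / (a + 1 / (b + y))
      = (1 / ((1 + a * (b + x)) * (1 + a * (b + y)))) * (x - y) := by
    have h1 : 0 < 1 + a * (b + x) := by positivity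
    have h2 : 0 < 1 + a * (b + y) := by positivity
    have e1 : 1 / (a + 1 / (b + x)) = (b + x) / (1 + a * (b + x)) := by
      field_simp; ring
    have e2 : 1 / (a + 1 / (b + y)) = (b + y) / (1 + a * (b + y)) := by
      field_simp; ring
    rw [e1, e2, div_sub_div _ _ h1.ne' h2.ne', one_div_mul_eq_div]
    congr 1; ring
  rw [e, abs_mul]
  apply mul_le_mul_of_nonneg_right _ (abs_nonneg _)
  rw [abs_of_pos (by positivity)]
  apply one_div_le_one_div_of_le (by positivity)
  nlinarith [sq_nonneg d]

lemma CF_cauchy (d : ℝ) (hd : 0 < d) (m : ℕ) : ∀ (k l : ℕ) (a : ℕ → ℝ), (∀ n, d ≤ a n) →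
    |CF (2 * m + k) a - CF (2 * m + l) a| ≤ (1 / (1 + d ^ 2)) ^ m * (1 / d) := by
  induction m with
  | zero =>
    intro k l a ha
    have h1 := CF_le k a d hd ha
    have h2 := CF_le l a d hd ha
    have h3 := CF_nonneg k a (fun n => hd.trans_le (ha _))
    have h4 := CF_nonneg l a (fun n => hd.trans_le (ha _))
    simp only [mul_zero, zero_add, pow_zero, one_mul]
    rw [abs_le]; constructor <;> linarith
  | succ m ih =>
    intro k l a ha
    rw [show 2 * (m + 1) + k = (2 * m + k) + 1 + 1 by ring,
      show 2 * (m + 1) + l = (2 * m + l) + 1 + 1 by ring]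
    simp only [CF]
    have hp : ∀ n, d ≤ a (n + 1 + 1) := fun n => ha _
    refine (two_step _ _ _ _ d hd (ha 0) (ha _) (CF_nonneg _ _ fun n => hd.trans_le (hp n))
      (CF_nonneg _ _ fun n => hd.trans_le (hp n))).trans ?_
    rw [pow_succ' _ m, mul_assoc]
    exact mul_le_mul_of_nonneg_left (ih k l _ hp) (by positivity)

lemma CF_mono (m : ℕ) : ∀ (k : ℕ) (a : ℕ → ℝ), (∀ n, 0 < a n) →
    CF (2 * m) a ≤ CF (2 * m + k) a := by
  induction m with
  | zero => intro k a ha; simpa [CF] using CF_nonneg k a ha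
  | succ m ih =>
    intro k a ha
    rw [show 2 * (m + 1) + k = (2 * m + k) + 1 + 1 by ring,
      show 2 * (m + 1) = (2 * m) + 1 + 1 by ring]
    simp only [CF]
    have h1 := ih k (fun n => a (n + 1 + 1)) (fun n => ha _)
    have h2 := CF_nonneg (2 * m) (fun n => a (n + 1 + 1)) (fun n => ha _)
    have h3 := ha 0
    have h4 := ha (0 + 1)
    have h5 := h2.trans h1
    apply one_div_le_one_div_of_le
    · positivity
    · gcongr

lemma CF_cont (S : Set ℝ) (k : ℕ) : ∀ (a : ℝ → ℕ → ℝ), (∀ n, ContinuousOn (fun x => a x n) S) →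
    (∀ x ∈ S, ∀ n, 0 < a x n) → ContinuousOn (fun x => CF k (a x)) S := by
  induction k with
  | zero => intro a _ _; simp only [CF]; exact continuousOn_const
  | succ k ih =>
    intro a hc hp
    simp only [CF]
    refine ContinuousOn.div continuousOn_const
      ((hc 0).add (ih (fun x n => a x (n + 1)) (fun n => hc _) (fun x hx n => hp x hx _))) ?_
    intro x hx
    have := hp x hx 0
    have := CF_nonneg k (fun n => a x (n + 1)) (fun n => hp x hx _)
    positivity

/-- uniform limit, continuity -/
lemma CF_limit (S : Set ℝ) (a : ℝ → ℕ → ℝ) (hc : ∀ n, ContinuousOn (fun x => a x n) S)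
    (d : ℝ) (hd : 0 < d) (hp : ∀ x ∈ S, ∀ n, d ≤ a x n) :
    ∃ G : ℝ → ℝ, ContinuousOn G S ∧ ∀ x ∈ S, Tendsto (fun k => CF k (a x)) atTop (𝓝 (G x)) := by
  have hk : Tendsto (fun m : ℕ => (1 / (1 + d ^ 2)) ^ m * (1 / d)) atTop (𝓝 0) := by
    have : Tendsto (fun m : ℕ => (1 / (1 + d ^ 2)) ^ m) atTop (𝓝 0) := by
      apply tendsto_pow_atTop_nhds_zero_of_lt_one (by positivity)
      rw [div_lt_one (by positivity)]
      nlinarith [sq_pos_of_pos hd]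
    simpa using this.mul_const (1 / d)
  have hU : UniformCauchySeqOn (fun k x => CF k (a x)) atTop S := by
    rw [Metric.uniformCauchySeqOn_iff]
    intro ε hε
    obtain ⟨m, hm⟩ := (hk.eventually (gt_mem_nhds hε)).exists
    refine ⟨2 * m, fun k hk' l hl x hx => ?_⟩
    obtain ⟨k, rfl⟩ := Nat.exists_eq_add_of_le hk'
    obtain ⟨l, rfl⟩ := Nat.exists_eq_add_of_le hl
    rw [Real.dist_eq]
    exact (CF_cauchy d hd m k l _ (hp x hx)).trans_lt hm
  have hex : ∀ x, ∃ g, x ∈ S → Tendsto (fun k => CF k (a x)) atTop (𝓝 g) := by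
    intro x
    by_cases hx : x ∈ S
    · obtain ⟨g, hg⟩ := cauchySeq_tendsto_of_complete (hU.cauchySeq hx)
      exact ⟨g, fun _ => hg⟩
    · exact ⟨0, fun h => absurd h hx⟩
  choose G hG using hex
  refine ⟨G, ?_, hG⟩
  refine (hU.tendstoUniformlyOn_of_tendsto hG).continuousOn (Eventually.of_forall fun k => ?_).frequently
  exact CF_cont S k a hc (fun x hx n => hd.trans_le (hp x hx n))

lemma CF_small (η : ℝ) (hη : 0 < η) (m : ℕ) : ∀ A : ℕ → ℝ, (∀ n, η ≤ A n) →
    ∃ L, m * η ≤ L ∧ Tendsto (fun ν : ℝ => CF (2 * m) (fun n => ν * A n) / ν) (𝓝[>] 0) (𝓝 L) := by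
  induction m with
  | zero => intro A _; exact ⟨0, by simp, by simp [CF]⟩
  | succ m ih =>
    intro A hA
    obtain ⟨L, hL, hT⟩ := ih (fun n => A (n + 1 + 1)) (fun n => hA _)
    have hA1 := hA 1
    refine ⟨A 1 + L, by push_cast; linarith, ?_⟩
    have hpos : 0 < A 1 + L := by
      have : 0 ≤ m * η := by positivity
      linarith
    have hid : Tendsto (fun ν : ℝ => ν) (𝓝[>] 0) (𝓝 0) := tendsto_nhdsWithin_of_tendsto_nhds tendsto_id
    have h1 := (((hid.pow 2).mul_const (A 0)).add
      ((hT.const_add (A 1)).inv₀ hpos.ne')).inv₀ (by simpa using hpos.ne')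
    simp only [ne_eq, OfNat.ofNat_ne_zero, not_false_eq_true, zero_pow, zero_mul, zero_add, inv_inv] at h1
    refine h1.congr' ?_
    filter_upwards [self_mem_nhdsWithin] with ν hν
    have hν : 0 < ν := hν
    rw [show 2 * (m + 1) = (2 * m) + 1 + 1 by ring]
    simp only [CF, zero_add]
    have h2 := CF_nonneg (2 * m) (fun n => ν * A (n + 1 + 1))
      (fun n => mul_pos hν (hη.trans_le (hA _)))
    set X := CF (2 * m) (fun n => ν * A (n + 1 + 1))
    have hA0 : 0 < A 0 := hη.trans_le (hA 0)
    have hA1 : 0 < A 1 := hη.trans_le (hA 1)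
    have e1 : A 1 + X / ν = (ν * A 1 + X) / ν := by field_simp
    rw [e1]
    have : 0 < ν * A 1 + X := by positivity
    rw [inv_div, div_div, inv_eq_one_div]
    congr 1
    field_simp

lemma main_abs (N r : ℕ → ℝ) (η c M : ℝ) (hη : 0 < η) (hN : ∀ n, η ≤ N n) (hr : ∀ n, 0 < r n)
    (hr1 : ∀ n, r n ≤ 1) (hc : 0 < c) (hM : 0 < M) :
    ∃ ν₀ > (0 : ℝ), ∀ ν : ℝ, 0 < ν → ν < ν₀ → ∃ lam > (0 : ℝ), ∃ G : ℝ,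
      Tendsto (fun k : ℕ => CF k (fun n => (lam + ν * N n) / r n)) atTop (𝓝 G) ∧
      -(c * (lam + ν * M)) + G = 0 := by
  obtain ⟨m, hm⟩ := exists_nat_gt (c * M / η)
  rw [div_lt_iff₀ hη] at hm
  have hA : ∀ n, η ≤ N n / r n := fun n => by
    rw [le_div_iff₀ (hr n)]
    nlinarith [hN n, hr1 n]
  obtain ⟨L, hL, hT⟩ := CF_small η hη m (fun n => N n / r n) hA
  have hev := hT.eventually (lt_mem_nhds (hm.trans_le hL))
  obtain ⟨ν₀, h0, hν₀⟩ := mem_nhdsGT_iff_exists_Ioo_subset.1 hev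
  refine ⟨ν₀, h0, fun ν hν hlt => ?_⟩
  have hsm : c * M < CF (2 * m) (fun n => ν * (N n / r n)) / ν := hν₀ ⟨hν, hlt⟩
  rw [lt_div_iff₀ hν] at hsm
  have hd : 0 < ν * η := by positivity
  have hlow : ∀ x ∈ Set.Ici (0 : ℝ), ∀ n, ν * η ≤ (x + ν * N n) / r n := by
    intro x hx n
    have hx : 0 ≤ x := hx
    have h1 : ν * η ≤ ν * (N n / r n) := mul_le_mul_of_nonneg_left (hA n) hν.le
    have h2 : 0 ≤ x / r n := div_nonneg hx (hr n).le
    rw [add_div, mul_div_assoc]; linarith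
  obtain ⟨G, hGc, hGT⟩ := CF_limit (Set.Ici 0) (fun x n => (x + ν * N n) / r n)
    (fun n => by fun_prop) (ν * η) hd hlow
  have hG0 : c * M * ν < G 0 := by
    refine hsm.trans_le ?_
    refine ge_of_tendsto (hGT 0 Set.self_mem_Ici) ?_
    filter_upwards [eventually_ge_atTop (2 * m)] with k hk
    obtain ⟨k, rfl⟩ := Nat.exists_eq_add_of_le hk
    simp only [zero_add, mul_div_assoc]
    exact CF_mono m k _ (fun n => mul_pos hν (hη.trans_le (hA n)))
  set Λ := 1 / (c * (ν * η)) with hΛ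
  have hΛ0 : 0 < Λ := by positivity
  have hG1 : G Λ ≤ 1 / (ν * η) := by
    refine le_of_tendsto (hGT Λ hΛ0.le) (Eventually.of_forall fun k => ?_)
    exact CF_le k _ _ hd (hlow Λ hΛ0.le)
  have hcont : ContinuousOn (fun x => c * (x + ν * M) - G x) (Set.Icc 0 Λ) := by
    refine ContinuousOn.sub (by fun_prop) (hGc.mono Set.Icc_subset_Ici_self)
  have hcΛ : c * Λ = 1 / (ν * η) := by rw [hΛ]; field_simp
  have hcm : 0 < c * (ν * M) := by positivity
  have hz : (0 : ℝ) ∈ Set.Ioo (c * (0 + ν * M) - G 0) (c * (Λ + ν * M) - G Λ) := by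
    constructor
    · nlinarith
    · rw [mul_add]; linarith
  obtain ⟨x, hx, hx0⟩ := intermediate_value_Ioo hΛ0.le hcont hz
  refine ⟨x, hx.1, G x, hGT x hx.1.le, ?_⟩
  simp only at hx0
  linarith

lemma list_coe (f : ℤ → ℝ) (l : List ℕ) :
    List.map f (do let a ← l; pure (a : ℤ)) = List.map (fun j : ℕ => f (j : ℤ)) l := by
  induction l with
  | nil => rfl
  | cons x l ih => simpa using ih

lemma nsq_nonneg' (v : ℤ × ℤ) : 0 ≤ nsq v := by unfold nsq; positivity

lemma main_side (p q : ℤ × ℤ) (hpq : wedge p q ≠ 0) (s : ℕ → ℤ) (hq : nsq q < nsq p)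
    (hs : ∀ j, nsq p < nsq (pt q p (s j))) :
    ∃ ν₀ > (0 : ℝ), ∀ ν : ℝ, 0 < ν → ν < ν₀ →
        ∃ lam > (0 : ℝ), ∃ G : ℝ,
          Tendsto (fun k : ℕ => cfL ((List.range k).map fun j => acoef p q lam ν (s j)))
            atTop (nhds G) ∧
          acoef p q lam ν 0 + G = 0 := by
  have hq0 : 0 < nsq q := by
    refine lt_of_le_of_ne (nsq_nonneg' q) fun h => hpq ?_
    have h1 : (q.1 : ℝ) = 0 := by
      unfold nsq at h; nlinarith [sq_nonneg (q.1 : ℝ), sq_nonneg (q.2 : ℝ)]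
    have h2 : (q.2 : ℝ) = 0 := by
      unfold nsq at h; nlinarith [sq_nonneg (q.1 : ℝ), sq_nonneg (q.2 : ℝ)]
    have h1 : q.1 = 0 := by exact_mod_cast h1
    have h2 : q.2 = 0 := by exact_mod_cast h2
    simp [wedge, h1, h2]
  have hp0 : 0 < nsq p := hq0.trans hq
  have hpt : pt q p 0 = q := by simp [pt]
  have hr0 : rho p q 0 < 0 := by
    rw [rho, hpt, sub_neg, lt_div_iff₀ hq0]; linarith
  obtain ⟨ν₀, h0, H⟩ := main_abs (fun j => nsq (pt q p (s j))) (fun j => rho p q (s j)) (nsq p)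
    (-(1 / rho p q 0)) (nsq q) hp0 (fun j => (hs j).le)
    (fun j => by
      have := hs j
      simp only [rho]
      rw [sub_pos, div_lt_one (hp0.trans this)]; exact this)
    (fun j => by
      have : 0 ≤ nsq p / nsq (pt q p (s j)) := div_nonneg hp0.le (nsq_nonneg' _)
      simp only [rho]; linarith)
    (by have := one_div_neg.2 hr0; linarith) hq0
  refine ⟨ν₀, h0, fun ν h1 h2 => ?_⟩
  obtain ⟨lam, hl, G, hT, hG⟩ := H ν h1 h2
  refine ⟨lam, hl, G, ?_, ?_⟩
  · simp only [CF_eq]; exact hT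
  · rw [← hG, acoef, hpt]; ring

/-- For type I₊ (resp. I₋) points and sufficiently small viscosity, the equation
`a₀(λ,ν) + g(λ,ν) = 0` (resp. `a₀(λ,ν) + f(λ,ν) = 0`) has a positive root. -/
theorem continuedFraction_equation_has_positive_root_typeIpm (p q : ℤ × ℤ)
    (hpq : wedge p q ≠ 0) :
    (typeIp p q →
      ∃ ν₀ > (0 : ℝ), ∀ ν : ℝ, 0 < ν → ν < ν₀ →
        ∃ lam > (0 : ℝ), ∃ G : ℝ,
          Tendsto (fun k : ℕ =>
              cfL ((List.range k).map fun j => acoef p q lam ν (-1 - (j : ℤ))))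
            atTop (nhds G) ∧
          acoef p q lam ν 0 + G = 0) ∧
    (typeIm p q →
      ∃ ν₀ > (0 : ℝ), ∀ ν : ℝ, 0 < ν → ν < ν₀ →
        ∃ lam > (0 : ℝ), ∃ F : ℝ,
          Tendsto (fun k : ℕ =>
              cfL ((List.range k).map fun j => acoef p q lam ν (1 + (j : ℤ))))
            atTop (nhds F) ∧
          acoef p q lam ν 0 + F = 0) := by
  refine ⟨fun h => ?_, fun h => ?_⟩
  · simp only [list_coe]
    exact main_side p q hpq (fun j => -1 - (j : ℤ)) h.1
      (fun j => h.2.2 _ (by omega) (by omega))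
  · simp only [list_coe]
    exact main_side p q hpq (fun j => 1 + (j : ℤ)) h.1
      (fun j => h.2.2 _ (by omega) (by omega))
end
end

section
/- Fix α > 0. Let p, q ∈ ℤ² with p∧q ≠ 0 and suppose q is of type I₀ relative to p, and set ρ′_n = 1 − ((1+α²‖p‖²)‖p‖²) / ((1+α²‖q+np‖²)‖q+np‖²). Then there exists ν₀ > 0 such that for every ν ∈ (0, ν₀) there exist λ > 0 and a sequence w:ℤ→ℝ, not identically zero, belonging to ℓ²_s(ℤ) for every s ≥ 0, satisfying the second grade fluid eigenvalue recurrence ρ′_{n−1}w_{n−1} − ρ′_{n+1}w_{n+1} − ν‖q+np‖²(1+α²‖q+np‖²)^{−1} w_n = λ w_n for all n ∈ ℤ. In particular, the linearized second grade fluid operator about the unidirectional steady state has a positive eigenvalue. -/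
open Filter Finset Topology

noncomputable section

/-- ρ′_n for the α-models. -/
def rhoAlpha (α : ℝ) (p q : ℤ × ℤ) (n : ℤ) : ℝ :=
  1 - ((1 + α ^ 2 * nsq p) * nsq p) /
        ((1 + α ^ 2 * nsq (pt q p n)) * nsq (pt q p n))

def TT (a : ℕ → ℝ) (m : ℝ) : ℕ → ℕ → ℝ
  | 0, _ => m
  | N + 1, n => 1 / (a n + TT a m N (n + 1))

theorem TT_bd (a : ℕ → ℝ) (m l : ℝ) (hl : 0 < l) (hm : 0 < m) (hml : m ≤ 1 / l)
    (ha : ∀ n, l ≤ a n) (N : ℕ) : ∀ n, 0 < TT a m N n ∧ TT a m N n ≤ 1 / l := by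
  induction N with
  | zero => intro n; exact ⟨hm, hml⟩
  | succ N ih =>
    intro n
    have h1 := ih (n + 1)
    have h2 := ha n
    simp only [TT]
    refine ⟨by have : 0 < a n + TT a m N (n + 1) := by linarith
               positivity, ?_⟩
    apply one_div_le_one_div_of_le hl
    linarith

theorem TT_low (a : ℕ → ℝ) (l K : ℝ) (hl : 0 < l) (hl1 : l ≤ 1) (hK : 1 ≤ K)
    (ha : ∀ n, l ≤ a n) (ha' : ∀ n, a n ≤ K * l) (N : ℕ) :
    ∀ n, 1 / (2 * K) ≤ TT a (1 / (2 * K)) N n ∧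
      TT a (1 / (2 * K)) N n ≤ 1 / (l + 1 / (2 * K)) := by
  have hm : 0 < 1 / (2 * K) := by positivity
  have hmK : 1 / (2 * K) * K = 1 / 2 := by field_simp
  have hm2 : 1 / (2 * K) ≤ 1 / 2 := by
    apply one_div_le_one_div_of_le <;> linarith
  generalize 1 / (2 * K) = m at *
  induction N with
  | zero =>
    intro n
    refine ⟨le_refl _, ?_⟩
    simp only [TT]
    rw [le_div_iff₀ (by positivity)]
    nlinarith
  | succ N ih =>
    intro n
    have h1 := ih (n + 1)
    have h2 := ha n
    have h3 := ha' n
    simp only [TT]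
    constructor
    · rw [le_div_iff₀ (by linarith)]
      have h4 : m * (a n + TT a m N (n + 1)) ≤ m * (K * l + 1 / (l + m)) := by
        apply mul_le_mul_of_nonneg_left _ hm.le
        linarith
      have h5 : m * (K * l + 1 / (l + m)) = l / 2 + m / (l + m) := by
        rw [mul_add, ← mul_assoc, hmK]; ring
      have h6 : m / (l + m) = 1 - l / (l + m) := by field_simp; ring
      have h7 : l / 2 ≤ l / (l + m) := by
        apply div_le_div_of_nonneg_left hl.le <;> linarith
      linarith
    · apply one_div_le_one_div_of_le <;> linarith

theorem TT_cont (a : ℝ → ℕ → ℝ) (m l : ℝ) (hl : 0 < l) (hm : 0 < m) (hml : m ≤ 1 / l)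
    (S : Set ℝ) (ha : ∀ x ∈ S, ∀ n, l ≤ a x n) (hc : ∀ n, ContinuousOn (fun x => a x n) S)
    (N : ℕ) : ∀ n, ContinuousOn (fun x => TT (a x) m N n) S := by
  induction N with
  | zero => intro n; exact continuousOn_const
  | succ N ih =>
    intro n
    simp only [TT]
    apply ContinuousOn.div continuousOn_const ((hc n).add (ih (n + 1)))
    intro x hx
    have := (TT_bd (a x) m l hl hm hml (ha x hx) N (n + 1)).1
    have := ha x hx n
    simp only [Pi.add_apply]
    linarith

/-- existence of limits of continued fractions with matching condition -/
theorem exists_cf (a b : ℝ → ℕ → ℝ) (g : ℝ → ℝ) (m l L : ℝ) (hl : 0 < l) (hlL : l ≤ L)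
    (hm : 0 < m) (hml : m ≤ 1 / l)
    (ha : ∀ x ∈ Set.Icc l L, ∀ n, l ≤ a x n) (hb : ∀ x ∈ Set.Icc l L, ∀ n, l ≤ b x n)
    (hca : ∀ n, Continuous (fun x => a x n)) (hcb : ∀ n, Continuous (fun x => b x n))
    (hg : Continuous g)
    (h1 : ∀ N, g l ≤ TT (a l) m N 0 + TT (b l) m N 0) (h2 : 2 / l ≤ g L) :
    ∃ x ∈ Set.Icc l L, ∃ u v : ℕ → ℝ, (∀ n, 0 ≤ u n ∧ u n ≤ 1 / l) ∧
      (∀ n, 0 ≤ v n ∧ v n ≤ 1 / l) ∧ (∀ n, u n * (a x n + u (n + 1)) = 1) ∧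
      (∀ n, v n * (b x n + v (n + 1)) = 1) ∧ u 0 + v 0 = g x := by
  have hroot : ∀ N, ∃ x ∈ Set.Icc l L, TT (a x) m N 0 + TT (b x) m N 0 = g x := by
    intro N
    have hc : ContinuousOn (fun x => TT (a x) m N 0 + TT (b x) m N 0 - g x) (Set.Icc l L) :=
      ((TT_cont a m l hl hm hml _ ha (fun n => (hca n).continuousOn) N 0).add
        (TT_cont b m l hl hm hml _ hb (fun n => (hcb n).continuousOn) N 0)).sub hg.continuousOn
    have := intermediate_value_Icc' hlL hc
    have h0 : (0 : ℝ) ∈ Set.Icc (TT (a L) m N 0 + TT (b L) m N 0 - g L)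
        (TT (a l) m N 0 + TT (b l) m N 0 - g l) := by
      constructor
      · have e1 := (TT_bd (a L) m l hl hm hml (ha L ⟨hlL, le_refl _⟩) N 0).2
        have e2 := (TT_bd (b L) m l hl hm hml (hb L ⟨hlL, le_refl _⟩) N 0).2
        have : 2 / l = 1 / l + 1 / l := by ring
        linarith
      · linarith [h1 N]
    obtain ⟨x, hx, hx'⟩ := this h0
    exact ⟨x, hx, by simpa [sub_eq_zero] using hx'⟩
  choose X hX hXe using hroot
  let Q : ℕ → ℝ × (ℕ → ℝ) × (ℕ → ℝ) := fun N =>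
    (X N, fun n => TT (a (X N)) m (N - n) n, fun n => TT (b (X N)) m (N - n) n)
  have hK : IsCompact ((Set.Icc l L) ×ˢ ((Set.univ.pi fun _ : ℕ => Set.Icc 0 (1 / l)) ×ˢ
      (Set.univ.pi fun _ : ℕ => Set.Icc 0 (1 / l)))) :=
    isCompact_Icc.prod ((isCompact_univ_pi fun _ => isCompact_Icc).prod
      (isCompact_univ_pi fun _ => isCompact_Icc))
  obtain ⟨⟨x, u, v⟩, hmem, φ, hφ, hlim⟩ := hK.tendsto_subseq (x := Q) (by
    intro N
    refine ⟨hX N, ?_, ?_⟩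
    · intro n _
      have := TT_bd (a (X N)) m l hl hm hml (ha _ (hX N)) (N - n) n
      exact ⟨this.1.le, this.2⟩
    · intro n _
      have := TT_bd (b (X N)) m l hl hm hml (hb _ (hX N)) (N - n) n
      exact ⟨this.1.le, this.2⟩)
  obtain ⟨hx, hu, hv⟩ := hmem
  have tx : Tendsto (fun k => X (φ k)) atTop (𝓝 x) := (Prod.tendsto_iff _ _).1 hlim |>.1
  have tuv := (Prod.tendsto_iff _ _).1 hlim |>.2
  have tu := (Prod.tendsto_iff _ _).1 tuv |>.1
  have tv := (Prod.tendsto_iff _ _).1 tuv |>.2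
  rw [tendsto_pi_nhds] at tu tv
  have key : ∀ (c : ℝ → ℕ → ℝ) (y : ℕ → ℝ), (∀ x ∈ Set.Icc l L, ∀ n, l ≤ c x n) →
      (∀ n, Continuous (fun x => c x n)) →
      (∀ n, Tendsto (fun k => TT (c (X (φ k))) m (φ k - n) n) atTop (𝓝 (y n))) →
      ∀ n, y n * (c x n + y (n + 1)) = 1 := by
    intro c y hc hcc ty n
    have t1 : Tendsto (fun k => c (X (φ k)) n) atTop (𝓝 (c x n)) :=
      ((hcc n).tendsto x).comp tx
    have t2 := (ty n).mul (t1.add (ty (n + 1)))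
    refine tendsto_nhds_unique t2 (tendsto_const_nhds.congr' ?_)
    filter_upwards [eventually_ge_atTop (n + 1)] with k hk
    have hk2 : n + 1 ≤ φ k := hk.trans (hφ.id_le k)
    obtain ⟨j, hj⟩ := Nat.exists_eq_add_of_le hk2
    have e1 : φ k - n = j + 1 := by omega
    have e2 : φ k - (n + 1) = j := by omega
    rw [e1, e2]
    simp only [TT]
    have := (TT_bd (c (X (φ k))) m l hl hm hml (hc _ (hX _)) j (n + 1)).1
    have := hc _ (hX (φ k)) n
    rw [one_div_mul_cancel]
    linarith
  refine ⟨x, hx, u, v, fun n => hu n trivial, fun n => hv n trivial,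
    key a u ha hca tu, key b v hb hcb tv, ?_⟩
  have t3 := (tu 0).add (tv 0)
  have t4 := (hg.tendsto x).comp tx
  refine tendsto_nhds_unique t3 (t4.congr fun k => ?_)
  simp only [Function.comp]
  exact (hXe (φ k)).symm

theorem prod_decay (l : ℝ) (hl : 0 < l) : ∃ C γ : ℝ, 0 < C ∧ 0 < γ ∧ γ < 1 ∧
    ∀ (a u : ℕ → ℝ), (∀ n, l ≤ a n) → (∀ n, 0 ≤ u n ∧ u n ≤ 1 / l) →
      (∀ n, u n * (a n + u (n + 1)) = 1) → ∀ n,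
      |∏ k ∈ range n, u k| ≤ C * γ ^ n := by
  have hθ : 0 < 1 / (1 + l ^ 2) := by positivity
  have hθ1 : 1 / (1 + l ^ 2) < 1 := by
    rw [div_lt_one (by positivity)]; nlinarith
  set γ := √(1 / (1 + l ^ 2)) with hγ
  have hγ0 : 0 < γ := Real.sqrt_pos.2 hθ
  have hγ2 : γ ^ 2 = 1 / (1 + l ^ 2) := Real.sq_sqrt hθ.le
  have hγ1 : γ < 1 := by nlinarith
  refine ⟨1 + 1 / (l * γ), γ, by positivity, hγ0, hγ1, ?_⟩
  intro a u ha hu hr n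
  have hpos : ∀ n, 0 ≤ ∏ k ∈ range n, u k := fun n => prod_nonneg fun k _ => (hu k).1
  rw [abs_of_nonneg (hpos n)]
  induction n using Nat.twoStepInduction with
  | zero => simp; positivity
  | one =>
    simp only [prod_range_one, pow_one]
    have : (1 + 1 / (l * γ)) * γ = γ + 1 / l := by field_simp
    linarith [(hu 0).2]
  | more n ih _ =>
    rw [prod_range_succ, prod_range_succ, mul_assoc, pow_add, hγ2,
      ← mul_assoc (1 + 1 / (l * γ))]
    apply mul_le_mul ih _ (mul_nonneg (hu _).1 (hu _).1) (by positivity)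
    rw [le_div_iff₀ (by positivity)]
    have h1 := hr n
    have h2 : u (n + 1) * l ≤ 1 := by
      have := (hu (n + 1)).2
      rwa [le_div_iff₀ hl] at this
    have h3 := mul_le_mul_of_nonneg_left (ha n) (hu n).1
    have h4 := mul_le_mul_of_nonneg_left h2 (mul_nonneg (hu n).1 hl.le)
    nlinarith

theorem abstract_instab (r e : ℤ → ℝ) (c E : ℝ) (hc : 0 < c) (hr0 : r 0 < 0)
    (hr : ∀ n, n ≠ 0 → c ≤ r n) (hr1 : ∀ n, n ≠ 0 → r n ≤ 1)
    (he : ∀ n, 0 ≤ e n) (heE : ∀ n, e n ≤ E) :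
    ∃ ν₀ > (0 : ℝ), ∀ ν : ℝ, 0 < ν → ν < ν₀ →
      ∃ lam > (0 : ℝ), ∃ w : ℤ → ℝ, w ≠ 0 ∧
        (∃ C γ : ℝ, 0 < C ∧ 0 < γ ∧ γ < 1 ∧ ∀ n, |w n| ≤ C * γ ^ n.natAbs) ∧
        ∀ n : ℤ, r (n - 1) * w (n - 1) - r (n + 1) * w (n + 1) - ν * e n * w n
          = lam * w n := by
  have hE : 0 ≤ E := (he 0).trans (heE 0)
  have hc1 : c ≤ 1 := (hr 1 (by norm_num)).trans (hr1 1 (by norm_num))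
  set K := (1 + E) / c with hKdef
  have hK : 1 ≤ K := by rw [hKdef, le_div_iff₀ hc]; linarith
  set m := 1 / (2 * K) with hmdef
  have hm : 0 < m := by positivity
  have hm1 : m ≤ 1 := by rw [hmdef, div_le_one (by positivity)]; linarith
  set R := - r 0 with hR
  have hRpos : 0 < R := by linarith
  set l := min 1 (2 * m * R / (1 + E)) with hldef
  have hl : 0 < l := lt_min one_pos (by positivity)
  have hl1 : l ≤ 1 := min_le_left _ _
  have hl2 : l * (1 + E) ≤ 2 * m * R := by
    have : l ≤ 2 * m * R / (1 + E) := min_le_right _ _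
    rwa [le_div_iff₀ (by positivity)] at this
  have hml : m ≤ 1 / l := by
    rw [le_div_iff₀ hl]; nlinarith
  refine ⟨l, hl, ?_⟩
  intro ν hν hνl
  have hlow : ∀ x, l ≤ x → ∀ n, n ≠ 0 → l ≤ (x + ν * e n) / r n := by
    intro x hx n hn
    have h1 := hr n hn
    have h2 := hr1 n hn
    have h3 := mul_nonneg hν.le (he n)
    rw [le_div_iff₀ (by linarith)]
    nlinarith
  have hup : ∀ n, n ≠ 0 → (l + ν * e n) / r n ≤ K * l := by
    intro n hn
    have h1 := hr n hn
    have h3 : ν * e n ≤ l * E := mul_le_mul hνl.le (heE n) (he n) hl.le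
    rw [hKdef, div_mul_eq_mul_div]
    apply div_le_div₀ (by positivity) (by linarith) hc h1
  let a : ℝ → ℕ → ℝ := fun x k => (x + ν * e (k + 1)) / r (k + 1)
  let b : ℝ → ℕ → ℝ := fun x k => (x + ν * e (-(k + 1))) / r (-(k + 1))
  have hp : ∀ k : ℕ, ((k : ℤ) + 1) ≠ 0 := fun k => by omega
  have hn : ∀ k : ℕ, (-((k : ℤ) + 1)) ≠ 0 := fun k => by omega
  let g : ℝ → ℝ := fun x => (x + ν * e 0) / R
  obtain ⟨x, hx, u, v, hu, hv, hur, hvr, huv⟩ := exists_cf a b g m l (l + 2 * R / l) hl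
    (by have : 0 ≤ 2 * R / l := by positivity
        linarith) hm hml
    (fun x hx n => hlow x hx.1 _ (hp n)) (fun x hx n => hlow x hx.1 _ (hn n))
    (fun n => by fun_prop) (fun n => by fun_prop) (by fun_prop)
    (by
      intro N
      have e1 := (TT_low (a l) l K hl hl1 hK (fun n => hlow l le_rfl _ (hp n))
        (fun n => hup _ (hp n)) N 0).1
      have e2 := (TT_low (b l) l K hl hl1 hK (fun n => hlow l le_rfl _ (hn n))
        (fun n => hup _ (hn n)) N 0).1
      have e3 : g l ≤ 2 * m := by
        simp only [g]
        rw [div_le_iff₀ hRpos]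
        have h3 : ν * e 0 ≤ l * E := mul_le_mul hνl.le (heE 0) (he 0) hl.le
        linarith
      linarith)
    (by
      simp only [g]
      rw [le_div_iff₀ hRpos]
      have h3 := mul_nonneg hν.le (he 0)
      have : 2 / l * R = 2 * R / l := by ring
      linarith)
  obtain ⟨C, γ, hC, hγ, hγ1, hdec⟩ := prod_decay l hl
  have du := hdec (a x) u (fun n => hlow x hx.1 _ (hp n)) hu hur
  have dv := hdec (b x) v (fun n => hlow x hx.1 _ (hn n)) hv hvr
  let z : ℤ → ℝ := fun n => if 0 ≤ n then ∏ k ∈ range n.natAbs, u k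
    else (-1) ^ n.natAbs * ∏ k ∈ range n.natAbs, v k
  have zp : ∀ n : ℕ, z n = ∏ k ∈ range n, u k := by
    intro n; simp [z]
  have zn : ∀ n : ℕ, z (-n) = (-1) ^ n * ∏ k ∈ range n, v k := by
    intro n
    rcases Nat.eq_zero_or_pos n with rfl | h
    · simp [z]
    · have : ¬ (0 : ℤ) ≤ -n := by omega
      simp only [z, if_neg this]
      simp
  have hrne : ∀ n, r n ≠ 0 := by
    intro n
    by_cases h : n = 0
    · subst h; exact hr0.ne
    · exact (hc.trans_le (hr n h)).ne'
  have hz : ∀ n, z (n - 1) - z (n + 1) = (x + ν * e n) / r n * z n := by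
    intro n
    rcases lt_trichotomy n 0 with h | h | h
    · obtain ⟨k, rfl⟩ : ∃ k : ℕ, n = -((k : ℤ) + 1) := ⟨(-n - 1).toNat, by omega⟩
      have e1 : -((k : ℤ) + 1) - 1 = -((k + 2 : ℕ) : ℤ) := by push_cast; ring
      have e2 : -((k : ℤ) + 1) + 1 = -(k : ℤ) := by ring
      have e3 : z (-((k : ℤ) + 1)) = (-1) ^ (k + 1) * ∏ k ∈ range (k + 1), v k := by
        rw [← zn (k + 1)]; push_cast; rfl
      rw [e1, e2, e3, zn, zn, prod_range_succ, prod_range_succ]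
      have := hvr k
      change v k * ((x + ν * e (-((k : ℤ) + 1))) / r (-((k : ℤ) + 1)) + v (k + 1)) = 1 at this
      rw [pow_add, pow_add]
      linear_combination (-(-1) ^ k * ∏ k ∈ range k, v k) * (-this)
    · subst h
      have e1 := zn 1
      have e2 := zp 1
      have e3 := zp 0
      simp at e1 e2 e3
      simp only [zero_sub, zero_add, e1, e2, e3]
      have : g x = -((x + ν * e 0) / r 0) := by
        simp only [g, hR]; rw [div_neg]
      linarith
    · obtain ⟨k, rfl⟩ : ∃ k : ℕ, n = (k : ℤ) + 1 := ⟨(n - 1).toNat, by omega⟩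
      have e1 : (k : ℤ) + 1 + 1 = ((k + 2 : ℕ) : ℤ) := by push_cast; ring
      have e2 : (k : ℤ) + 1 - 1 = (k : ℤ) := by ring
      have e3 : z ((k : ℤ) + 1) = ∏ k ∈ range (k + 1), u k := by
        rw [← zp (k + 1)]; push_cast; rfl
      rw [e1, e2, e3, zp, zp, prod_range_succ, prod_range_succ]
      have := hur k
      change u k * ((x + ν * e ((k : ℤ) + 1)) / r ((k : ℤ) + 1) + u (k + 1)) = 1 at this
      linear_combination (∏ k ∈ range k, u k) * (-this)
  have hzd : ∀ n, |z n| ≤ C * γ ^ n.natAbs := by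
    intro n
    simp only [z]
    split_ifs
    · exact du _
    · rw [abs_mul, abs_pow, abs_neg, abs_one, one_pow, one_mul]; exact dv _
  refine ⟨x, hl.trans_le hx.1, fun n => z n / r n, ?_, ?_, ?_⟩
  · intro h
    have h0 := congrFun h 0
    have e3 := zp 0
    simp at e3
    simp [e3, hr0.ne] at h0
  · have hmin : 0 < min c R := lt_min hc hRpos
    refine ⟨C / min c R, γ, by positivity, hγ, hγ1, fun n => ?_⟩
    rw [abs_div, div_mul_eq_mul_div]
    apply div_le_div₀ (by positivity) (hzd n) hmin
    by_cases h : n = 0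
    · subst h
      rw [abs_of_neg hr0]; exact min_le_right _ _
    · exact (min_le_left _ _).trans ((hr n h).trans (le_abs_self _))
  · intro n
    have h1 := hz n
    rw [mul_div_cancel₀ _ (hrne _), mul_div_cancel₀ _ (hrne _)]
    rw [h1]
    ring

theorem memL2s_of_decay (w : ℤ → ℝ) (C γ : ℝ) (hγ : 0 < γ) (hγ1 : γ < 1)
    (h : ∀ n, |w n| ≤ C * γ ^ n.natAbs) (s : ℝ) : memL2s s w := by
  unfold memL2s
  obtain ⟨k, hk⟩ := exists_nat_ge (2 * s)
  have hg2 : γ ^ 2 < 1 := by nlinarith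
  have key : Summable fun n : ℕ => 2 * C ^ 2 * (((n : ℝ) ^ k * (γ ^ 2) ^ n)) := by
    apply Summable.mul_left
    apply summable_pow_mul_geometric_of_norm_lt_one
    rw [Real.norm_of_nonneg (by positivity)]; exact hg2
  have bd : ∀ n : ℤ, n ≠ 0 → (1 + |(n : ℝ)| ^ (2 * s)) * (w n) ^ 2 ≤
      2 * C ^ 2 * ((n.natAbs : ℝ) ^ k * (γ ^ 2) ^ n.natAbs) := by
    intro n hn
    have e1 : |(n : ℝ)| = (n.natAbs : ℝ) := by
      rw [Nat.cast_natAbs]; push_cast; rfl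
    have e2 : (1 : ℝ) ≤ (n.natAbs : ℝ) := by
      exact_mod_cast Int.natAbs_pos.2 hn
    rw [e1]
    have e3 : (n.natAbs : ℝ) ^ (2 * s) ≤ (n.natAbs : ℝ) ^ k := by
      rw [← Real.rpow_natCast]
      exact Real.rpow_le_rpow_of_exponent_le e2 hk
    have e4 : (1 : ℝ) ≤ (n.natAbs : ℝ) ^ k := one_le_pow₀ e2
    have e5 : (w n) ^ 2 ≤ C ^ 2 * (γ ^ 2) ^ n.natAbs := by
      have := pow_le_pow_left₀ (abs_nonneg _) (h n) 2
      rw [sq_abs, mul_pow, ← pow_mul, mul_comm n.natAbs 2, pow_mul] at this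
      exact this
    calc _ ≤ (2 * (n.natAbs : ℝ) ^ k) * (C ^ 2 * (γ ^ 2) ^ n.natAbs) := by
          apply mul_le_mul (by linarith) e5 (sq_nonneg _) (by positivity)
      _ = _ := by ring
  have nn : ∀ n : ℤ, 0 ≤ (1 + |(n : ℝ)| ^ (2 * s)) * (w n) ^ 2 := fun n => by positivity
  apply Summable.of_nat_of_neg
  · rw [← summable_nat_add_iff 1]
    refine Summable.of_nonneg_of_le (fun n => nn _) (fun n => ?_) ((summable_nat_add_iff 1).2 key)
    have := bd ((n + 1 : ℕ) : ℤ) (by omega)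
    simpa only [Int.natAbs_natCast] using this
  · rw [← summable_nat_add_iff 1]
    refine Summable.of_nonneg_of_le (fun n => nn _) (fun n => ?_) ((summable_nat_add_iff 1).2 key)
    have := bd (-((n + 1 : ℕ) : ℤ)) (by omega)
    simpa only [Int.natAbs_neg, Int.natAbs_natCast] using this

/-- Instability of unidirectional flows of type I₀ for the 2D second grade fluid
model: for all sufficiently small viscosity the linearized operator has a
positive eigenvalue with eigenvector in ℓ²_s(ℤ) for every `s ≥ 0`. -/
theorem instability_secondGrade_typeI0 (α : ℝ) (hα : 0 < α) (p q : ℤ × ℤ)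
    (hpq : wedge p q ≠ 0) (hI0 : typeI0 p q) :
    ∃ ν₀ > (0 : ℝ), ∀ ν : ℝ, 0 < ν → ν < ν₀ →
      ∃ lam > (0 : ℝ), ∃ w : ℤ → ℝ, w ≠ 0 ∧ (∀ s : ℝ, 0 ≤ s → memL2s s w) ∧
        ∀ n : ℤ, rhoAlpha α p q (n - 1) * w (n - 1)
          - rhoAlpha α p q (n + 1) * w (n + 1)
          - ν * nsq (pt q p n) * (1 + α ^ 2 * nsq (pt q p n))⁻¹ * w n
          = lam * w n := by
  have hP0 : 0 ≤ nsq p := by unfold nsq; positivity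
  have hint : ∀ v : ℤ × ℤ, nsq v = ((v.1 ^ 2 + v.2 ^ 2 : ℤ) : ℝ) := by
    intro v; unfold nsq; push_cast; rfl
  have hN : ∀ n, n ≠ 0 → nsq p + 1 ≤ nsq (pt q p n) := by
    intro n hn
    have := hI0.2 n hn
    rw [hint, hint] at this ⊢
    have h2 := Int.cast_lt.1 this
    exact_mod_cast h2
  have hpt0 : pt q p 0 = q := by simp [pt]
  have hq : 0 < nsq q := by
    have h0 : 0 ≤ nsq q := by unfold nsq; positivity
    rcases h0.lt_or_eq with h | h
    · exact h
    · exfalso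
      apply hpq
      unfold nsq at h
      have h1 : (q.1 : ℝ) = 0 := by nlinarith [sq_nonneg (q.1 : ℝ), sq_nonneg (q.2 : ℝ)]
      have h2 : (q.2 : ℝ) = 0 := by nlinarith [sq_nonneg (q.1 : ℝ), sq_nonneg (q.2 : ℝ)]
      have h1' : q.1 = 0 := by exact_mod_cast h1
      have h2' : q.2 = 0 := by exact_mod_cast h2
      simp [wedge, h1', h2']
  have hα2 : 0 < α ^ 2 := by positivity
  have hnn : ∀ n, 0 ≤ nsq (pt q p n) := by intro n; unfold nsq; positivity
  obtain ⟨ν₀, hν₀, H⟩ := abstract_instab (rhoAlpha α p q)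
    (fun n => nsq (pt q p n) * (1 + α ^ 2 * nsq (pt q p n))⁻¹) (1 / (nsq p + 1)) (1 / α ^ 2)
    (by positivity)
    (by
      unfold rhoAlpha
      rw [hpt0]
      have hqp := hI0.1
      have : 1 < ((1 + α ^ 2 * nsq p) * nsq p) / ((1 + α ^ 2 * nsq q) * nsq q) := by
        rw [one_lt_div (by positivity)]
        have : α ^ 2 * nsq q ≤ α ^ 2 * nsq p := mul_le_mul_of_nonneg_left hqp.le hα2.le
        apply mul_lt_mul' (by linarith) hqp hq.le (by positivity)
      linarith)
    (by
      intro n hn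
      have h1 := hN n hn
      unfold rhoAlpha
      have h2 : ((1 + α ^ 2 * nsq p) * nsq p) /
          ((1 + α ^ 2 * nsq (pt q p n)) * nsq (pt q p n)) ≤
          ((1 + α ^ 2 * nsq p) * nsq p) / ((1 + α ^ 2 * nsq p) * (nsq p + 1)) := by
        apply div_le_div_of_nonneg_left (by positivity) (by positivity)
        have : α ^ 2 * nsq p ≤ α ^ 2 * nsq (pt q p n) :=
          mul_le_mul_of_nonneg_left (by linarith) hα2.le
        apply mul_le_mul (by linarith) h1 (by positivity)
        have := hnn n
        positivity
      have h3 : ((1 + α ^ 2 * nsq p) * nsq p) / ((1 + α ^ 2 * nsq p) * (nsq p + 1)) =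
          1 - 1 / (nsq p + 1) := by
        have : (1 + α ^ 2 * nsq p) ≠ 0 := by positivity
        rw [mul_div_mul_left _ _ this]
        field_simp
        ring
      linarith)
    (by
      intro n hn
      unfold rhoAlpha
      have := hnn n
      have : 0 ≤ ((1 + α ^ 2 * nsq p) * nsq p) /
          ((1 + α ^ 2 * nsq (pt q p n)) * nsq (pt q p n)) := by positivity
      linarith)
    (by intro n; have := hnn n; positivity)
    (by
      intro n
      have := hnn n
      rw [← div_eq_mul_inv, div_le_div_iff₀ (by positivity) hα2]
      linarith)
  refine ⟨ν₀, hν₀, fun ν h1 h2 => ?_⟩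
  obtain ⟨lam, hlam, w, hw, ⟨C, γ, hC, hγ, hγ1, hd⟩, hrec⟩ := H ν h1 h2
  refine ⟨lam, hlam, w, hw, fun s _ => memL2s_of_decay w C γ hγ hγ1 hd s, fun n => ?_⟩
  have := hrec n
  rw [mul_assoc ν]
  exact this
end
end

section
/- Fix α > 0. Let p, q ∈ ℤ² with p∧q ≠ 0 and suppose q is of type I₀ relative to p, and set ρ′_n = 1 − ((1+α²‖p‖²)‖p‖²) / ((1+α²‖q+np‖²)‖q+np‖²). Then there exists ν₀ > 0 such that for every ν ∈ (0, ν₀) there exist λ > 0 and a sequence w:ℤ→ℝ, not identically zero, belonging to ℓ²_s(ℤ) for every s ≥ 0, satisfying the Navier–Stokes-α eigenvalue recurrence ρ′_{n−1}w_{n−1} − ρ′_{n+1}w_{n+1} − ν‖q+np‖² w_n = λ w_n for all n ∈ ℤ. In particular, the linearized Navier–Stokes-α operator about the unidirectional steady state has a positive eigenvalue. -/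
open Filter Finset Topology

noncomputable section

/-- finite continued fraction along a sequence -/
def cfR (a : ℕ → ℝ) : ℕ → ℕ → ℝ
  | 0, _ => 0
  | k + 1, n => 1 / (a n + cfR a k (n + 1))

lemma cfR_nonneg (a : ℕ → ℝ) (ha : ∀ n, 0 < a n) (k : ℕ) : ∀ n, 0 ≤ cfR a k n := by
  induction k with
  | zero => intro n; simp [cfR]
  | succ k ih =>
    intro n
    have := ih (n + 1)
    have := ha n
    simp only [cfR]
    positivity

lemma cfR_le (a : ℕ → ℝ) (ha : ∀ n, 0 < a n) (k n : ℕ) : cfR a k n ≤ 1 / a n := by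
  cases k with
  | zero => simp only [cfR]; have := ha n; positivity
  | succ k =>
    simp only [cfR]
    have := cfR_nonneg a ha k (n + 1)
    exact one_div_le_one_div_of_le (ha n) (by linarith)

lemma cfR_cont (c d : ℕ → ℝ) (hc : ∀ n, 1 ≤ c n) (hd : ∀ n, 1 ≤ d n) (ν : ℝ) (hν : 0 < ν)
    (k : ℕ) : ∀ n, ContinuousOn (fun l : ℝ => cfR (fun n => l * c n + ν * d n) k n) (Set.Ici 0) := by
  induction k with
  | zero => intro n; simp only [cfR]; exact continuousOn_const
  | succ k ih =>
    intro n
    simp only [cfR]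
    refine ContinuousOn.div continuousOn_const ?_ ?_
    · exact ContinuousOn.add (by fun_prop) (ih (n + 1))
    · intro l hl
      have hl : 0 ≤ l := hl
      have hpos : ∀ n, 0 < l * c n + ν * d n := fun n => by
        have := hc n
        have := hd n
        positivity
      have := cfR_nonneg _ hpos k (n + 1)
      have := hpos n
      positivity

lemma cfR_lower (c d : ℕ → ℝ) (hc : ∀ n, 1 ≤ c n) (hd : ∀ n, 1 ≤ d n) (j : ℕ) :
    ∀ n, ∃ ν₀ > (0 : ℝ), ∀ ν : ℝ, 0 < ν → ν < ν₀ → ∀ k, 2 * j ≤ k →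
      ν * (j / 2) ≤ cfR (fun n => ν * c n + ν * d n) k n := by
  induction j with
  | zero =>
    intro n
    refine ⟨1, one_pos, fun ν hν _ k _ => ?_⟩
    have hpos : ∀ n, 0 < ν * c n + ν * d n := fun n => by
      have := hc n
      have := hd n
      positivity
    simpa using cfR_nonneg _ hpos k n
  | succ j ih =>
    intro n
    obtain ⟨ν₁, hν₁, h⟩ := ih (n + 2)
    set B : ℝ := c n + d n with hB
    have hB2 : 2 ≤ B := by have := hc n; have := hd n; linarith
    set D : ℝ := 2 * B * (j + 2) with hD
    have hDp : 0 < D := by positivity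
    have hD1 : 1 ≤ D := by
      have : (0 : ℝ) ≤ j := by positivity
      nlinarith
    refine ⟨min ν₁ (1 / D), by positivity, fun ν hν hlt k hk => ?_⟩
    obtain ⟨k, rfl⟩ : ∃ m, k = m + 2 := ⟨k - 2, by omega⟩
    have h0 := h ν hν (lt_of_lt_of_le hlt (min_le_left _ _)) k (by omega)
    have hνD : ν * D < 1 := by
      have := lt_of_lt_of_le hlt (min_le_right _ _)
      rwa [lt_div_iff₀ hDp] at this
    have hν1 : ν < 1 := by nlinarith
    simp only [cfR]
    set x := cfR (fun n => ν * c n + ν * d n) k (n + 1 + 1) with hx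
    have h0 : ν * (j / 2) ≤ x := h0
    have hj : (0 : ℝ) ≤ j := by positivity
    have hy : ν * (1 + j / 2) ≤ ν * c (n + 1) + ν * d (n + 1) + x := by
      have := hc (n + 1)
      have := hd (n + 1)
      nlinarith
    set y := ν * c (n + 1) + ν * d (n + 1) + x with hy'
    have hL : 0 < ν * (1 + j / 2 : ℝ) := by positivity
    have hyp : 0 < y := lt_of_lt_of_le hL hy
    have h1 : 1 / y ≤ 1 / (ν * (1 + j / 2)) := one_div_le_one_div_of_le hL hy
    have h2 : 1 / (ν * B + 1 / (ν * (1 + j / 2))) ≤ 1 / (ν * c n + ν * d n + 1 / y) := by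
      apply one_div_le_one_div_of_le
      · have := hc n
        have := hd n
        positivity
      · rw [hB]; linarith
    refine le_trans ?_ h2
    rw [le_div_iff₀ (by positivity)]
    push_cast
    have e1 : ν * ((j + 1) / 2) * (ν * B + 1 / (ν * (1 + j / 2)))
       = ν * ν * B * ((j + 1) / 2) + (j + 1) / (j + 2 : ℝ) := by
      field_simp
      ring
    rw [e1]
    have e2 : (j + 1) / (j + 2 : ℝ) = 1 - 1 / (j + 2 : ℝ) := by field_simp; ring
    rw [e2]
    have e3 : ν * ν * B * ((j + 1) / 2) ≤ 1 / (j + 2 : ℝ) := by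
      rw [le_div_iff₀ (by positivity)]
      have : ν * B * (j + 2) ≤ 1 / 2 := by rw [hD] at hνD; nlinarith
      have h5 : ν * (j + 1) ≤ 1 := by
        have : ν * (j + 1) ≤ ν * D := by
          apply mul_le_mul_of_nonneg_left _ hν.le
          rw [hD]; nlinarith
        linarith
      have h6 : 0 ≤ ν * (j + 1 : ℝ) := by positivity
      have h7 : 0 ≤ ν * B * (j + 2 : ℝ) := by positivity
      nlinarith
    linarith

lemma core (c d c' d' : ℕ → ℝ) (hc : ∀ n, 1 ≤ c n) (hd : ∀ n, 1 ≤ d n)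
    (hc' : ∀ n, 1 ≤ c' n) (hd' : ∀ n, 1 ≤ d' n) (e f : ℝ) (he : 0 < e) (hf : 0 < f) :
    ∃ ν₀ > (0 : ℝ), ∀ ν : ℝ, 0 < ν → ν < ν₀ → ∃ lam > (0 : ℝ), ∃ r s : ℕ → ℝ,
      (∀ n, 0 ≤ r n) ∧ (∀ n, 0 ≤ s n) ∧
      (∀ n, r n * (lam * c n + ν * d n + r (n + 1)) = 1) ∧
      (∀ n, s n * (lam * c' n + ν * d' n + s (n + 1)) = 1) ∧
      r 0 + s 0 = lam * e + ν * f := by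
  obtain ⟨j, hj⟩ := exists_nat_gt (2 * (e + f))
  obtain ⟨ν₀, hν₀, hlow⟩ := cfR_lower c d hc hd j 0
  refine ⟨ν₀, hν₀, fun ν hν hlt => ?_⟩
  set a : ℝ → ℕ → ℝ := fun l n => l * c n + ν * d n with ha
  set a' : ℝ → ℕ → ℝ := fun l n => l * c' n + ν * d' n with ha'
  have hap : ∀ l, 0 ≤ l → ∀ n, 0 < a l n := fun l hl n => by
    have := hc n
    have := hd n
    simp only [ha]
    positivity
  have hap' : ∀ l, 0 ≤ l → ∀ n, 0 < a' l n := fun l hl n => by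
    have := hc' n
    have := hd' n
    simp only [ha']
    positivity
  have hbd : ∀ l, 0 ≤ l → ∀ k n, cfR (a l) k n ∈ Set.Icc 0 (1 / ν) := fun l hl k n => by
    refine ⟨cfR_nonneg _ (hap l hl) k n, (cfR_le _ (hap l hl) k n).trans ?_⟩
    apply one_div_le_one_div_of_le hν
    have := hc n
    have := hd n
    simp only [ha]
    nlinarith
  have hbd' : ∀ l, 0 ≤ l → ∀ k n, cfR (a' l) k n ∈ Set.Icc 0 (1 / ν) := fun l hl k n => by
    refine ⟨cfR_nonneg _ (hap' l hl) k n, (cfR_le _ (hap' l hl) k n).trans ?_⟩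
    apply one_div_le_one_div_of_le hν
    have := hc' n
    have := hd' n
    simp only [ha']
    nlinarith
  set L : ℝ := ν + 1 + 2 / e with hL
  have hL1 : 1 ≤ L := by have : 0 ≤ 2 / e := by positivity
                         linarith
  have hνL : ν ≤ L := by have : 0 ≤ 2 / e := by positivity
                         linarith
  have hLe : 2 ≤ L * e := by
    have : L * e = (ν + 1) * e + 2 := by rw [hL]; field_simp
    rw [this]
    have : 0 ≤ (ν + 1) * e := by positivity
    linarith
  have hex : ∀ k : ℕ, ∃ l ∈ Set.Icc ν L,
      cfR (a l) (k + 2 * j) 0 + cfR (a' l) (k + 2 * j) 0 - (l * e + ν * f) = 0 := by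
    intro k
    have hcont : ContinuousOn (fun l : ℝ => cfR (a l) (k + 2 * j) 0 + cfR (a' l) (k + 2 * j) 0
        - (l * e + ν * f)) (Set.Icc ν L) := by
      refine ContinuousOn.sub (ContinuousOn.add ?_ ?_) (by fun_prop)
      · exact (cfR_cont c d hc hd ν hν _ 0).mono (fun x hx => hν.le.trans hx.1)
      · exact (cfR_cont c' d' hc' hd' ν hν _ 0).mono (fun x hx => hν.le.trans hx.1)
    refine intermediate_value_Icc' hνL hcont ⟨?_, ?_⟩
    · have h0 : (0:ℝ) ≤ L := by linarith
      have h1 := cfR_le _ (hap L h0) (k + 2 * j) 0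
      have h2 := cfR_le _ (hap' L h0) (k + 2 * j) 0
      have h3 : 1 / a L 0 ≤ 1 := by
        rw [div_le_one (hap L h0 0)]
        have := hc 0
        have := hd 0
        simp only [ha]
        nlinarith
      have h4 : 1 / a' L 0 ≤ 1 := by
        rw [div_le_one (hap' L h0 0)]
        have := hc' 0
        have := hd' 0
        simp only [ha']
        nlinarith
      have : 0 < ν * f := by positivity
      linarith
    · have h1 := hlow ν hν hlt (k + 2 * j) (by omega)
      have h2 := (hbd' ν hν.le (k + 2 * j) 0).1
      have : ν * (e + f) ≤ ν * (j / 2) := by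
        apply mul_le_mul_of_nonneg_left _ hν.le
        linarith
      have h1 : ν * (j / 2) ≤ cfR (a ν) (k + 2 * j) 0 := h1
      linarith
  choose l hl hl0 using hex
  have hlp : ∀ k, 0 ≤ l k := fun k => hν.le.trans (hl k).1
  let x : ℕ → ℝ × (ℕ → ℝ) × (ℕ → ℝ) := fun k =>
    (l k, fun n => cfR (a (l k)) (k + 2 * j - n) n, fun n => cfR (a' (l k)) (k + 2 * j - n) n)
  have hK : IsCompact ((Set.Icc ν L) ×ˢ ((Set.univ.pi fun _ : ℕ => Set.Icc (0:ℝ) (1 / ν)) ×ˢ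
      (Set.univ.pi fun _ : ℕ => Set.Icc (0:ℝ) (1 / ν)))) :=
    isCompact_Icc.prod ((isCompact_univ_pi fun _ => isCompact_Icc).prod
      (isCompact_univ_pi fun _ => isCompact_Icc))
  obtain ⟨⟨lam, r, s⟩, hmem, φ, hφ, hlim⟩ := hK.tendsto_subseq (x := x) (fun k =>
    ⟨hl k, fun n _ => hbd _ (hlp k) _ n, fun n _ => hbd' _ (hlp k) _ n⟩)
  have t0 : Tendsto (fun k => l (φ k)) atTop (𝓝 lam) := (continuous_fst.tendsto _).comp hlim
  have tr : ∀ n, Tendsto (fun k => cfR (a (l (φ k))) (φ k + 2 * j - n) n) atTop (𝓝 (r n)) := fun n =>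
    (((continuous_apply n).comp (continuous_fst.comp continuous_snd)).tendsto (lam, r, s)).comp hlim
  have ts : ∀ n, Tendsto (fun k => cfR (a' (l (φ k))) (φ k + 2 * j - n) n) atTop (𝓝 (s n)) := fun n =>
    (((continuous_apply n).comp (continuous_snd.comp continuous_snd)).tendsto (lam, r, s)).comp hlim
  refine ⟨lam, lt_of_lt_of_le hν hmem.1.1, r, s, fun n => (hmem.2.1 n trivial).1,
    fun n => (hmem.2.2 n trivial).1, fun n => ?_, fun n => ?_, ?_⟩
  · have t := (tr n).mul (((t0.mul_const (c n)).add_const (ν * d n)).add (tr (n + 1)))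
    refine tendsto_nhds_unique t ?_
    refine Tendsto.congr' ?_ tendsto_const_nhds
    filter_upwards [eventually_ge_atTop (n + 1)] with k hk
    have : k ≤ φ k := hφ.id_le k
    obtain ⟨m, hm⟩ : ∃ m, φ k + 2 * j - n = m + 1 := ⟨φ k + 2 * j - n - 1, by omega⟩
    have hm' : φ k + 2 * j - (n + 1) = m := by omega
    rw [hm, hm']
    simp only [cfR]
    have h1 := hap _ (hlp (φ k)) n
    have h2 := cfR_nonneg _ (hap _ (hlp (φ k))) m (n + 1)
    have h3 : 0 < a (l (φ k)) n + cfR (a (l (φ k))) m (n + 1) := by positivity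
    exact (one_div_mul_cancel h3.ne').symm
  · have t := (ts n).mul (((t0.mul_const (c' n)).add_const (ν * d' n)).add (ts (n + 1)))
    refine tendsto_nhds_unique t ?_
    refine Tendsto.congr' ?_ tendsto_const_nhds
    filter_upwards [eventually_ge_atTop (n + 1)] with k hk
    have : k ≤ φ k := hφ.id_le k
    obtain ⟨m, hm⟩ : ∃ m, φ k + 2 * j - n = m + 1 := ⟨φ k + 2 * j - n - 1, by omega⟩
    have hm' : φ k + 2 * j - (n + 1) = m := by omega
    rw [hm, hm']
    simp only [cfR]
    have h1 := hap' _ (hlp (φ k)) n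
    have h2 := cfR_nonneg _ (hap' _ (hlp (φ k))) m (n + 1)
    have h3 : 0 < a' (l (φ k)) n + cfR (a' (l (φ k))) m (n + 1) := by positivity
    exact (one_div_mul_cancel h3.ne').symm
  · have t := (tr 0).add (ts 0)
    have t' := (t0.mul_const e).add_const (ν * f)
    refine tendsto_nhds_unique t (t'.congr fun k => ?_)
    have := hl0 (φ k)
    simp only [Nat.sub_zero]
    linarith

lemma summ_side (u : ℕ → ℝ) (s : ℝ) (hs : 0 ≤ s)
    (h : ∀ ε > (0:ℝ), ∀ᶠ n : ℕ in atTop, |u (n + 1)| ≤ ε * |u n|) :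
    Summable fun n : ℕ => (1 + |(n : ℝ)| ^ (2 * s)) * (u n) ^ 2 := by
  set T : ℝ := (2:ℝ) ^ (2 * s) with hT
  have hT1 : 1 ≤ T := Real.one_le_rpow (by norm_num) (by linarith)
  refine summable_of_ratio_norm_eventually_le (r := 1 / 2) (by norm_num) ?_
  filter_upwards [h (1 / (2 * T)) (by positivity), eventually_ge_atTop 1] with n hn hn1
  have hn1' : (1:ℝ) ≤ n := by exact_mod_cast hn1
  have e1 : |((n + 1 : ℕ) : ℝ)| ^ (2 * s) ≤ T * |(n:ℝ)| ^ (2 * s) := by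
    rw [hT, ← Real.mul_rpow (by norm_num) (abs_nonneg _)]
    apply Real.rpow_le_rpow (abs_nonneg _) _ (by linarith)
    push_cast
    rw [abs_of_nonneg (by positivity), abs_of_nonneg (by positivity)]
    linarith
  have p1 : 0 ≤ |((n + 1 : ℕ) : ℝ)| ^ (2 * s) := by positivity
  have p2 : 0 ≤ |(n : ℝ)| ^ (2 * s) := by positivity
  have e2 : (u (n + 1)) ^ 2 ≤ (1 / (2 * T)) ^ 2 * (u n) ^ 2 := by
    rw [← sq_abs (u (n + 1)), ← sq_abs (u n), ← mul_pow]
    exact pow_le_pow_left₀ (abs_nonneg _) hn 2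
  rw [Real.norm_of_nonneg (by positivity), Real.norm_of_nonneg (by positivity)]
  calc (1 + |((n + 1 : ℕ) : ℝ)| ^ (2 * s)) * (u (n + 1)) ^ 2
      ≤ (T * (1 + |(n : ℝ)| ^ (2 * s))) * ((1 / (2 * T)) ^ 2 * (u n) ^ 2) := by
        apply mul_le_mul _ e2 (by positivity) (by positivity)
        linarith
    _ = (1 / (4 * T)) * ((1 + |(n : ℝ)| ^ (2 * s)) * (u n) ^ 2) := by
        field_simp
        ring
    _ ≤ 1 / 2 * ((1 + |(n : ℝ)| ^ (2 * s)) * (u n) ^ 2) := by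
        apply mul_le_mul_of_nonneg_right _ (by positivity)
        exact one_div_le_one_div_of_le (by norm_num) (by linarith)

/-- decay on one side -/
lemma side_decay (ν lam : ℝ) (hν : 0 < ν) (hl : 0 < lam) (N ρ r z u : ℕ → ℝ)
    (hN : ∀ n, 1 ≤ N n) (hNt : Tendsto N atTop atTop)
    (hρ : ∀ n, 0 < ρ (n + 1)) (hρ1 : ∀ n, ρ (n + 1) ≤ 1)
    (hr : ∀ n, 0 ≤ r n)
    (hrr : ∀ n, r n * (lam * (1 / ρ (n + 1)) + ν * (N (n + 1) / ρ (n + 1)) + r (n + 1)) = 1)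
    (hz : ∀ n, |z (n + 1)| = |z n| * r n) (hu : ∀ n, u n = z n / ρ n) :
    ∀ ε > (0:ℝ), ∀ᶠ n : ℕ in atTop, |u (n + 1)| ≤ ε * |u n| := by
  intro ε hε
  have h1 := (tendsto_add_atTop_iff_nat 1).2 hNt
  filter_upwards [h1.eventually_ge_atTop (1 / (ε * ν)), eventually_ge_atTop 1] with n hn hn1
  obtain ⟨m, rfl⟩ : ∃ m, n = m + 1 := ⟨n - 1, by omega⟩
  have a0 := hρ m
  have a1 := hρ (m + 1)
  have a2 := hρ1 m
  have b := hN (m + 1 + 1)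
  have hr0 := hr (m + 1)
  have hr1 := hr (m + 1 + 1)
  have hle : r (m + 1) * (N (m + 1 + 1) * ν) ≤ ρ (m + 1 + 1) := by
    have := hrr (m + 1)
    have e : r (m + 1) * (N (m + 1 + 1) * ν) = ρ (m + 1 + 1) * (r (m + 1) * (ν * (N (m + 1 + 1) / ρ (m + 1 + 1)))) := by
      field_simp
    rw [e]
    have : r (m + 1) * (ν * (N (m + 1 + 1) / ρ (m + 1 + 1))) ≤ 1 := by
      rw [← this]
      apply mul_le_mul_of_nonneg_left _ hr0
      have : 0 ≤ lam * (1 / ρ (m + 1 + 1)) := by positivity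
      linarith
    nlinarith
  have hn' : 1 ≤ N (m + 1 + 1) * ν * ε := by
    rw [div_le_iff₀ (by positivity)] at hn
    linarith
  have hr2 : r (m + 1) ≤ ε * ρ (m + 1 + 1) := by
    have := mul_le_mul_of_nonneg_left hn' hr0
    nlinarith
  rw [hu, hu, abs_div, abs_div, hz (m + 1), abs_of_pos a0, abs_of_pos a1, div_le_iff₀ a1]
  have hz0 := abs_nonneg (z (m + 1))
  calc |z (m + 1)| * r (m + 1) ≤ |z (m + 1)| * (ε * ρ (m + 1 + 1)) :=
        mul_le_mul_of_nonneg_left hr2 hz0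
    _ ≤ (|z (m + 1)| / ρ (m + 1)) * (ε * ρ (m + 1 + 1)) := by
        apply mul_le_mul_of_nonneg_right _ (by positivity)
        rw [le_div_iff₀ a0]
        nlinarith
    _ = _ := by ring

lemma nsq_one_le (v : ℤ × ℤ) (hv : v ≠ 0) : 1 ≤ nsq v := by
  have h : (1:ℤ) ≤ v.1 ^ 2 + v.2 ^ 2 := by
    by_contra hlt
    have h1 := sq_nonneg v.1
    have h2 := sq_nonneg v.2
    have h3 : v.1 ^ 2 = 0 := by omega
    have h4 : v.2 ^ 2 = 0 := by omega
    exact hv (Prod.ext (by simpa using h3) (by simpa using h4))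
  unfold nsq
  exact_mod_cast h

lemma nsq_pt_lower (p q : ℤ × ℤ) (hP : 1 ≤ nsq p) : ∃ C : ℝ, ∀ n : ℤ, |(n:ℝ)| - C ≤ nsq (pt q p n) := by
  set D : ℝ := 2 * |(p.1:ℝ) * q.1 + p.2 * q.2| + 1 with hD
  refine ⟨D ^ 2, fun n => ?_⟩
  have e : nsq (pt q p n) = nsq q + n * (2 * ((p.1:ℝ) * q.1 + p.2 * q.2)) + n ^ 2 * nsq p := by
    simp only [nsq, pt]; push_cast; ring
  have h0 : 0 ≤ nsq q := by unfold nsq; positivity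
  have h1 : -(|(n:ℝ)| * (D - 1)) ≤ n * (2 * ((p.1:ℝ) * q.1 + p.2 * q.2)) := by
    have := neg_abs_le (n * (2 * ((p.1:ℝ) * q.1 + p.2 * q.2)))
    rw [abs_mul, abs_mul, abs_two] at this
    rw [hD]; linarith
  have h2 : |(n:ℝ)| ^ 2 ≤ n ^ 2 * nsq p := by
    rw [sq_abs]; nlinarith [sq_nonneg (n:ℝ)]
  rw [e]
  nlinarith [sq_nonneg (|(n:ℝ)| - D / 2), sq_nonneg D]
/-- Instability of unidirectional flows of type I₀ for the 2D Navier-Stokes-α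
model: for all sufficiently small viscosity the linearized operator has a
positive eigenvalue with eigenvector in ℓ²_s(ℤ) for every `s ≥ 0`. -/
theorem instability_NavierStokesAlpha_typeI0 (α : ℝ) (hα : 0 < α) (p q : ℤ × ℤ)
    (hpq : wedge p q ≠ 0) (hI0 : typeI0 p q) :
    ∃ ν₀ > (0 : ℝ), ∀ ν : ℝ, 0 < ν → ν < ν₀ →
      ∃ lam > (0 : ℝ), ∃ w : ℤ → ℝ, w ≠ 0 ∧ (∀ s : ℝ, 0 ≤ s → memL2s s w) ∧
        ∀ n : ℤ, rhoAlpha α p q (n - 1) * w (n - 1)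
          - rhoAlpha α p q (n + 1) * w (n + 1)
          - ν * nsq (pt q p n) * w n = lam * w n := by
  have hp0 : p ≠ 0 := by
    rintro rfl
    simp [wedge] at hpq
  have hP : 1 ≤ nsq p := nsq_one_le p hp0
  have hN1 : ∀ n, 1 ≤ nsq (pt q p n) := fun n => nsq_one_le _ (fun h => hpq (by
    have h1 : q.1 + n * p.1 = 0 := congrArg Prod.fst h
    have h2 : q.2 + n * p.2 = 0 := congrArg Prod.snd h
    unfold wedge
    linear_combination p.1 * h2 - p.2 * h1))
  obtain ⟨C, hC⟩ := nsq_pt_lower p q hP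
  set N : ℤ → ℝ := fun n => nsq (pt q p n) with hN
  set ρ : ℤ → ℝ := rhoAlpha α p q with hρ
  have hN0 : N 0 = nsq q := by simp [hN, pt]
  have hα2 : 0 < α ^ 2 := by positivity
  have hρn : ∀ n, n ≠ 0 → 0 < ρ n ∧ ρ n ≤ 1 := by
    intro n hn
    have h1 := hI0.2 n hn
    have h2 := hN1 n
    simp only [hρ, rhoAlpha]
    constructor
    · rw [sub_pos, div_lt_one (by positivity)]
      have : 1 + α ^ 2 * nsq p < 1 + α ^ 2 * nsq (pt q p n) := by nlinarith
      exact mul_lt_mul'' this h1 (by positivity) (by linarith)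
    · have : 0 ≤ ((1 + α ^ 2 * nsq p) * nsq p) /
        ((1 + α ^ 2 * nsq (pt q p n)) * nsq (pt q p n)) := by positivity
      linarith
  have hρ0 : ρ 0 < 0 := by
    have h2 := hN1 0
    have h1 : nsq (pt q p 0) < nsq p := by rw [show nsq (pt q p 0) = nsq q from hN0]; exact hI0.1
    simp only [hρ, rhoAlpha]
    rw [sub_neg, one_lt_div (by positivity)]
    have : 1 + α ^ 2 * nsq (pt q p 0) < 1 + α ^ 2 * nsq p := by nlinarith
    exact mul_lt_mul'' this h1 (by positivity) (by linarith)
  have hρne : ∀ n, ρ n ≠ 0 := fun n => by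
    by_cases h : n = 0
    · rw [h]; exact hρ0.ne
    · exact (hρn n h).1.ne'
  have hpc : ∀ n : ℤ, n ≠ 0 → 1 ≤ 1 / ρ n := fun n hn => by
    rw [le_div_iff₀ (hρn n hn).1]; linarith [(hρn n hn).2]
  have hpd : ∀ n : ℤ, n ≠ 0 → 1 ≤ N n / ρ n := fun n hn => by
    rw [le_div_iff₀ (hρn n hn).1]; have := (hρn n hn).2; have := hN1 n; simp only [hN]; linarith
  have hne1 : ∀ n : ℕ, ((n + 1 : ℕ) : ℤ) ≠ 0 := fun n => by omega
  have hne2 : ∀ n : ℕ, -((n + 1 : ℕ) : ℤ) ≠ 0 := fun n => by omega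
  obtain ⟨ν₀, hν₀, hmain⟩ := core (fun n => 1 / ρ ((n + 1 : ℕ) : ℤ))
    (fun n => N ((n + 1 : ℕ) : ℤ) / ρ ((n + 1 : ℕ) : ℤ))
    (fun n => 1 / ρ (-((n + 1 : ℕ) : ℤ))) (fun n => N (-((n + 1 : ℕ) : ℤ)) / ρ (-((n + 1 : ℕ) : ℤ)))
    (fun n => hpc _ (hne1 n)) (fun n => hpd _ (hne1 n))
    (fun n => hpc _ (hne2 n)) (fun n => hpd _ (hne2 n))
    (1 / (-ρ 0)) (N 0 / (-ρ 0)) (by have : 0 < -ρ 0 := by linarith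
                                    positivity)
    (by have : 0 < -ρ 0 := by linarith
        have : 0 < N 0 := by linarith [hN1 0]
        positivity)
  refine ⟨ν₀, hν₀, fun ν hν hlt => ?_⟩
  obtain ⟨lam, hlam, r, s, hr, hs, hrr, hss, h0⟩ := hmain ν hν hlt
  refine ⟨lam, hlam, ?_⟩
  let zp : ℕ → ℝ := fun n => ∏ i ∈ Finset.range n, r i
  let zm : ℕ → ℝ := fun n => ∏ i ∈ Finset.range n, (-s i)
  have zps : ∀ n, zp (n + 1) = zp n * r n := fun n => Finset.prod_range_succ _ _
  have zms : ∀ n, zm (n + 1) = zm n * (-s n) := fun n => Finset.prod_range_succ _ _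
  let z : ℤ → ℝ := fun n => if 0 ≤ n then zp n.toNat else zm (-n).toNat
  have zpos : ∀ n : ℕ, z (n : ℤ) = zp n := fun n => by simp [z]
  have zneg : ∀ n : ℕ, z (-(n : ℤ)) = zm n := fun n => by
    cases n with
    | zero => simp [z, zp, zm]
    | succ n =>
      have : ¬ (0 : ℤ) ≤ -((n + 1 : ℕ) : ℤ) := by omega
      simp only [z, if_neg this, neg_neg, Int.toNat_natCast]
  have hNtp : Tendsto (fun n : ℕ => N (n : ℤ)) atTop atTop := by
    refine tendsto_atTop_mono (fun n => hC n) ?_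
    have : Tendsto (fun n : ℕ => (n : ℝ) + -C) atTop atTop :=
      tendsto_atTop_add_const_right _ _ tendsto_natCast_atTop_atTop
    refine this.congr fun n => ?_
    simp [sub_eq_add_neg]
  have hNtm : Tendsto (fun n : ℕ => N (-(n : ℤ))) atTop atTop := by
    refine tendsto_atTop_mono (fun n => hC (-(n : ℤ))) ?_
    have : Tendsto (fun n : ℕ => (n : ℝ) + -C) atTop atTop :=
      tendsto_atTop_add_const_right _ _ tendsto_natCast_atTop_atTop
    refine this.congr fun n => ?_
    simp [sub_eq_add_neg]
  refine ⟨fun n => z n / ρ n, ?_, ?_, ?_⟩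
  · intro h
    have := congrFun h 0
    have h1 : z 0 = 1 := by simp [z, zp]
    simp only [h1, Pi.zero_apply] at this
    exact (one_div_ne_zero (hρne 0)) this
  · intro t ht
    refine Summable.of_nat_of_neg ?_ ?_
    · have := summ_side (fun n : ℕ => z (n : ℤ) / ρ (n : ℤ)) t ht
        (side_decay ν lam hν hlam (fun n => N (n : ℤ)) (fun n => ρ (n : ℤ)) r
          (fun n => z (n : ℤ)) _ (fun n => hN1 n) hNtp (fun n => (hρn _ (hne1 n)).1)
          (fun n => (hρn _ (hne1 n)).2) hr hrr
          (fun n => by simp only [zpos, zps, abs_mul, abs_of_nonneg (hr n)]) (fun n => rfl))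
      simpa using this
    · have := summ_side (fun n : ℕ => z (-(n : ℤ)) / ρ (-(n : ℤ))) t ht
        (side_decay ν lam hν hlam (fun n => N (-(n : ℤ))) (fun n => ρ (-(n : ℤ))) s
          (fun n => z (-(n : ℤ))) _ (fun n => hN1 _) hNtm (fun n => (hρn _ (hne2 n)).1)
          (fun n => (hρn _ (hne2 n)).2) hs hss
          (fun n => by simp only [zneg, zms, abs_mul, abs_neg, abs_of_nonneg (hs n)])
          (fun n => rfl))
      simpa using this
  · intro n
    have key : z (n - 1) - z (n + 1) = (lam * (1 / ρ n) + ν * (N n / ρ n)) * z n := by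
      rcases lt_trichotomy n 0 with hn | hn | hn
      · obtain ⟨k, rfl⟩ : ∃ k : ℕ, n = -((k + 1 : ℕ) : ℤ) := ⟨(-n).toNat - 1, by omega⟩
        rw [show -((k + 1 : ℕ) : ℤ) - 1 = -((k + 1 + 1 : ℕ) : ℤ) by push_cast; ring,
          show -((k + 1 : ℕ) : ℤ) + 1 = -(k : ℤ) by push_cast; ring, zneg, zneg, zneg, zms, zms]
        have := hss k
        linear_combination (zm k) * this
      · subst hn
        have e1 : z (0 - 1) = -s 0 := by
          have := zneg 1
          rw [zms] at this
          simpa [zm] using this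
        have e2 : z (0 + 1) = r 0 := by
          have := zpos 1
          rw [zps] at this
          simpa [zp] using this
        have e3 : z 0 = 1 := by simp [z, zp]
        rw [e1, e2, e3]
        have e4 : 1 / (-ρ 0) = -(1 / ρ 0) := by rw [div_neg]
        have e5 : N 0 / (-ρ 0) = -(N 0 / ρ 0) := by rw [div_neg]
        rw [e4, e5] at h0
        linarith
      · obtain ⟨k, rfl⟩ : ∃ k : ℕ, n = ((k + 1 : ℕ) : ℤ) := ⟨n.toNat - 1, by omega⟩
        rw [show ((k + 1 : ℕ) : ℤ) - 1 = (k : ℤ) by push_cast; ring,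
          show ((k + 1 : ℕ) : ℤ) + 1 = ((k + 1 + 1 : ℕ) : ℤ) by push_cast; ring,
          zpos, zpos, zpos, zps, zps]
        have := hrr k
        linear_combination (-(zp k)) * this
    have hx : ∀ m, ρ m * (z m / ρ m) = z m := fun m => mul_div_cancel₀ _ (hρne m)
    simp only [hx]
    have h2 : N n = nsq (pt q p n) := rfl
    rw [← h2]
    linear_combination key
end
end
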